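/- arXiv:1503.00163 — 8 statements merged into one kernel-verified Lean document; each statement's English description precedes it below -/
import Mathlib

section
/- Fix σ < 0 and a positive integer m, and set θ = m|σ|. The weights V_{n,k} = |σ|^{k-1} (∏_{i=1}^{k-1}(m-i)) / (m|σ|+1)_{n-1} for 1 ≤ k ≤ min(n,m), and V_{n,k} = 0 for min(n,m) < k ≤ n, satisfy the Gibbs-type forward recursion V_{n,k} = (n - σk) V_{n+1,k} + V_{n+1,k+1} for all 1 ≤ k ≤ n, with V_{1,1} = 1. -/
/-- Rising factorial `(x)_n = x (x+1) ⋯ (x+n-1)`, with `(x)_0 = 1`. -/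
noncomputable def risingFactorial (x : ℝ) : ℕ → ℝ
  | 0 => 1
  | n + 1 => risingFactorial x n * (x + n)

/-- Pitman–Yor weights with `σ < 0` and `θ = m|σ|`:
`V_{n,k} = |σ|^{k-1} (∏_{i=1}^{k-1}(m-i)) / (m|σ|+1)_{n-1}` for `1 ≤ k ≤ min(n,m)`,
and `V_{n,k} = 0` otherwise. -/
noncomputable def pyNegV (σ : ℝ) (m : ℕ) (n k : ℕ) : ℝ :=
  if k ≤ min n m then
    |σ| ^ (k - 1) * (∏ i ∈ Finset.Icc 1 (k - 1), ((m : ℝ) - i)) /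
      risingFactorial ((m : ℝ) * |σ| + 1) (n - 1)
  else 0

theorem risingFactorial_pos_aux (x : ℝ) (hx : 0 < x) (n : ℕ) : 0 < risingFactorial x n := by
  induction n with
  | zero => simp [risingFactorial]
  | succ n ih =>
    rw [risingFactorial]
    positivity

/-- For `σ < 0` and a positive integer `m` (with `θ = m|σ|`), the weights `pyNegV`
satisfy the Gibbs-type forward recursion `V_{n,k} = (n - σk) V_{n+1,k} + V_{n+1,k+1}`
for all `1 ≤ k ≤ n`, with `V_{1,1} = 1`. -/
theorem pyNeg_weights_gibbs_recursion (σ : ℝ) (hσ : σ < 0) (m : ℕ) (hm : 1 ≤ m) :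
    (∀ n k : ℕ, 1 ≤ k → k ≤ n →
      pyNegV σ m n k =
        ((n : ℝ) - σ * k) * pyNegV σ m (n + 1) k + pyNegV σ m (n + 1) (k + 1)) ∧
    pyNegV σ m 1 1 = 1 := by
  refine ⟨?_, ?_⟩
  · intro n k hk hkn
    obtain ⟨K, rfl⟩ : ∃ K, k = K + 1 := ⟨k - 1, by omega⟩
    obtain ⟨N, rfl⟩ : ∃ N, n = N + 1 := ⟨n - 1, by omega⟩
    have hx : 0 < (m : ℝ) * |σ| + 1 := by positivity
    have hR := (risingFactorial_pos_aux _ hx N).ne'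
    have hy : (m : ℝ) * |σ| + 1 + N ≠ 0 := by positivity
    have habs : σ = -|σ| := by rw [abs_of_neg hσ]; ring
    unfold pyNegV
    simp only [Nat.add_sub_cancel, risingFactorial]
    generalize risingFactorial ((m : ℝ) * |σ| + 1) N = R at *
    generalize |σ| = s at *
    subst habs
    obtain ⟨D, hD⟩ : ∃ D : ℝ, D = (m : ℝ) * s + 1 + N := ⟨_, rfl⟩
    have hN : ((N + 1 : ℕ) : ℝ) = D - m * s := by rw [hD]; push_cast; ring
    rw [← hD] at hy ⊢
    rw [hN]
    clear hN hD
    by_cases h1 : K + 1 ≤ m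
    · rw [if_pos (by omega), if_pos (by omega)]
      by_cases h2 : K + 1 + 1 ≤ m
      · rw [if_pos (by omega), Finset.prod_Icc_succ_top (by omega)]
        generalize (∏ i ∈ Finset.Icc 1 K, ((m : ℝ) - i)) = P
        field_simp
        push_cast
        ring
      · rw [if_neg (by omega)]
        have hmK : (m : ℝ) = K + 1 := by
          have : m = K + 1 := by omega
          rw [this]; push_cast; ring
        generalize (∏ i ∈ Finset.Icc 1 K, ((m : ℝ) - i)) = P
        rw [hmK]
        field_simp
        push_cast
        ring
    · rw [if_neg (by omega), if_neg (by omega), if_neg (by omega)]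
      simp
  · simp [pyNegV, risingFactorial, hm]
end

section
/- For γ ∈ (0,1), the Gnedin-model weights V_{n,k} = (k-1)! (1-γ)_{k-1} (γ)_{n-k} / ((n-1)! (1+γ)_{n-1}), defined for integers 1 ≤ k ≤ n, satisfy the Gibbs-type forward recursion with σ = -1, namely V_{n,k} = (n + k) V_{n+1,k} + V_{n+1,k+1} for all 1 ≤ k ≤ n, and V_{1,1} = 1. -/
/-- Gnedin-model weights
`V_{n,k} = (k-1)! (1-γ)_{k-1} (γ)_{n-k} / ((n-1)! (1+γ)_{n-1})`. -/
noncomputable def gnedinV (γ : ℝ) (n k : ℕ) : ℝ :=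
  ((k - 1).factorial : ℝ) * risingFactorial (1 - γ) (k - 1) * risingFactorial γ (n - k) /
    (((n - 1).factorial : ℝ) * risingFactorial (1 + γ) (n - 1))

/-- For `γ ∈ (0,1)`, the Gnedin-model weights satisfy the Gibbs-type forward recursion
with `σ = -1`, namely `V_{n,k} = (n + k) V_{n+1,k} + V_{n+1,k+1}` for all `1 ≤ k ≤ n`,
and `V_{1,1} = 1`. -/
theorem gnedin_weights_gibbs_recursion (γ : ℝ) (hγ0 : 0 < γ) (hγ1 : γ < 1) :
    (∀ n k : ℕ, 1 ≤ k → k ≤ n →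
      gnedinV γ n k =
        ((n : ℝ) + k) * gnedinV γ (n + 1) k + gnedinV γ (n + 1) (k + 1)) ∧
    gnedinV γ 1 1 = 1 := by
  have hpos : ∀ m : ℕ, 0 < risingFactorial (1 + γ) m := by
    intro m
    induction m with
    | zero => simp [risingFactorial]
    | succ m ih =>
      rw [risingFactorial]
      positivity
  refine ⟨?_, by simp [gnedinV, risingFactorial]⟩
  intro n k hk hkn
  obtain ⟨a, rfl⟩ := Nat.exists_eq_add_of_le' hk
  obtain ⟨d, rfl⟩ := Nat.exists_eq_add_of_le hkn
  have e1 : a + 1 + d - (a + 1) = d := by omega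
  have e2 : a + 1 + d - 1 = a + d := by omega
  have e3 : a + 1 + d + 1 - (a + 1) = d + 1 := by omega
  have e4 : a + 1 + d + 1 - 1 = a + d + 1 := by omega
  have e5 : a + 1 + d + 1 - (a + 1 + 1) = d := by omega
  have h1 := (hpos (a + d)).ne'
  have h2 : ((a + d).factorial : ℝ) ≠ 0 := by positivity
  have h3 : (1 + γ + (a + d : ℝ)) ≠ 0 := by positivity
  have h4 : ((a : ℝ) + d + 1) ≠ 0 := by positivity
  unfold gnedinV
  rw [e1, e2, e3, e4, e5]
  simp only [Nat.add_sub_cancel, risingFactorial, Nat.factorial_succ]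
  push_cast
  field_simp
  ring
end

section
/- For σ ∈ (0,1) and β > 0, the normalized generalized gamma weights V_{n,k} = (e^β σ^{k-1} / Γ(n)) · ∑_{i=0}^{n-1} C(n-1,i) (-1)^i β^{i/σ} Γ(k - i/σ; β), defined for integers 1 ≤ k ≤ n, satisfy the Gibbs-type forward recursion V_{n,k} = (n - σk) V_{n+1,k} + V_{n+1,k+1} for all 1 ≤ k ≤ n, and V_{1,1} = 1. -/
open MeasureTheory

/-- Upper incomplete gamma function `Γ(x; a) = ∫_a^∞ s^{x-1} e^{-s} ds`. -/
noncomputable def upperIncGamma (x a : ℝ) : ℝ :=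
  ∫ s in Set.Ioi a, s ^ (x - 1) * Real.exp (-s)

/-- Normalized generalized gamma weights
`V_{n,k} = (e^β σ^{k-1} / Γ(n)) ∑_{i=0}^{n-1} C(n-1,i) (-1)^i β^{i/σ} Γ(k - i/σ; β)`. -/
noncomputable def nggV (σ β : ℝ) (n k : ℕ) : ℝ :=
  Real.exp β * σ ^ (k - 1) / Real.Gamma n *
    ∑ i ∈ Finset.range n,
      ((n - 1).choose i : ℝ) * (-1 : ℝ) ^ i * β ^ ((i : ℝ) / σ) *
        upperIncGamma ((k : ℝ) - (i : ℝ) / σ) β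

lemma aux_int (x a : ℝ) (ha : 0 < a) :
    IntegrableOn (fun s : ℝ => s ^ (x - 1) * Real.exp (-s)) (Set.Ioi a) := by
  apply integrable_of_isBigO_exp_neg (b := 1/2) (by norm_num)
  · apply ContinuousOn.mul
    · intro s hs
      exact (Real.continuousAt_rpow_const s _ (Or.inl (ne_of_gt (lt_of_lt_of_le ha hs)))).continuousWithinAt
    · fun_prop
  · have h := (isLittleO_rpow_exp_pos_mul_atTop (x - 1) (b := 1/2) (by norm_num)).isBigO
    have h2 := h.mul (Asymptotics.isBigO_refl (fun s : ℝ => Real.exp (-s)) Filter.atTop)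
    refine h2.congr_right fun s => ?_
    rw [← Real.exp_add]
    congr 1
    ring

lemma aux_rec (x a : ℝ) (ha : 0 < a) :
    upperIncGamma (x + 1) a = x * upperIncGamma x a + a ^ x * Real.exp (-a) := by
  have i1 := aux_int x a ha
  have i2 := aux_int (x + 1) a ha
  have hlim : Filter.Tendsto (fun s : ℝ => s ^ x * Real.exp (-s)) Filter.atTop (nhds 0) := by
    simpa using tendsto_rpow_mul_exp_neg_mul_atTop_nhds_zero x 1 one_pos
  have key := integral_Ioi_of_hasDerivAt_of_tendsto' (a := a) (m := 0)
    (f := fun s : ℝ => s ^ x * Real.exp (-s))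
    (f' := fun s => x * (s ^ (x - 1) * Real.exp (-s)) - s ^ (x + 1 - 1) * Real.exp (-s))
    (by
      intro s hs
      have hs0 : s ≠ 0 := ne_of_gt (lt_of_lt_of_le ha hs)
      have := (Real.hasDerivAt_rpow_const (p := x) (Or.inl hs0)).mul ((hasDerivAt_neg s).exp)
      convert! this using 1
      rw [add_sub_cancel_right]
      ring)
    ((i1.const_mul x).sub i2) hlim
  rw [integral_sub (i1.const_mul x) i2, integral_const_mul] at key
  unfold upperIncGamma
  linarith

/-- For `σ ∈ (0,1)` and `β > 0`, the normalized generalized gamma weights satisfy the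
Gibbs-type forward recursion `V_{n,k} = (n - σk) V_{n+1,k} + V_{n+1,k+1}` for all
`1 ≤ k ≤ n`, and `V_{1,1} = 1`. -/
theorem ngg_weights_gibbs_recursion (σ β : ℝ) (hσ0 : 0 < σ) (hσ1 : σ < 1) (hβ : 0 < β) :
    (∀ n k : ℕ, 1 ≤ k → k ≤ n →
      nggV σ β n k =
        ((n : ℝ) - σ * k) * nggV σ β (n + 1) k + nggV σ β (n + 1) (k + 1)) ∧
    nggV σ β 1 1 = 1 := by
  have term : ∀ (j : ℕ) (i : ℕ), β ^ ((i : ℝ) / σ) * upperIncGamma (((j + 1 : ℕ) : ℝ) - (i : ℝ) / σ) β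
      = ((j : ℝ) - i / σ) * (β ^ ((i : ℝ) / σ) * upperIncGamma ((j : ℝ) - (i : ℝ) / σ) β)
        + β ^ j * Real.exp (-β) := by
    intro j i
    have e : ((j + 1 : ℕ) : ℝ) - (i : ℝ) / σ = ((j : ℝ) - i / σ) + 1 := by push_cast; ring
    have e2 : β ^ ((i : ℝ) / σ) * β ^ ((j : ℝ) - i / σ) = β ^ j := by
      rw [← Real.rpow_add hβ, add_sub_cancel, Real.rpow_natCast]
    rw [e, aux_rec _ _ hβ, ← e2]
    ring
  constructor
  · intro n k hk hkn
    obtain ⟨m, rfl⟩ : ∃ m, n = m + 1 := ⟨n - 1, by omega⟩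
    obtain ⟨j, rfl⟩ : ∃ j, k = j + 1 := ⟨k - 1, by omega⟩
    have alt : ∑ i ∈ Finset.range (m + 1 + 1), (((m + 1).choose i : ℝ) * (-1 : ℝ) ^ i) = 0 := by
      have := Int.alternating_sum_range_choose_of_ne (n := m + 1) (by omega)
      have h2 := congrArg (Int.cast : ℤ → ℝ) this
      push_cast at h2
      rw [← h2]
      exact Finset.sum_congr rfl fun i _ => mul_comm _ _
    unfold nggV
    simp only [Nat.add_sub_cancel]
    set a : ℕ → ℝ := fun i => β ^ ((i : ℝ) / σ) * upperIncGamma (((j + 1 : ℕ) : ℝ) - (i : ℝ) / σ) β with ha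
    have hS2 : ∑ i ∈ Finset.range (m + 1 + 1), ((m + 1).choose i : ℝ) * (-1 : ℝ) ^ i * β ^ ((i : ℝ) / σ) *
        upperIncGamma (((j + 1 + 1 : ℕ) : ℝ) - (i : ℝ) / σ) β
        = ∑ i ∈ Finset.range (m + 1 + 1), ((m + 1).choose i : ℝ) * (-1 : ℝ) ^ i * ((((j + 1 : ℕ) : ℝ) - i / σ) * a i) := by
      have : ∀ i ∈ Finset.range (m + 1 + 1), ((m + 1).choose i : ℝ) * (-1 : ℝ) ^ i * β ^ ((i : ℝ) / σ) *
        upperIncGamma (((j + 1 + 1 : ℕ) : ℝ) - (i : ℝ) / σ) β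
        = ((m + 1).choose i : ℝ) * (-1 : ℝ) ^ i * ((((j + 1 : ℕ) : ℝ) - i / σ) * a i)
          + ((m + 1).choose i : ℝ) * (-1 : ℝ) ^ i * (β ^ (j + 1) * Real.exp (-β)) := by
        intro i _
        rw [mul_assoc _ (β ^ ((i : ℝ) / σ)), term]
        ring
      rw [Finset.sum_congr rfl this, Finset.sum_add_distrib, ← Finset.sum_mul, alt]
      ring
    have key : ((m + 1 : ℕ) : ℝ) * ∑ i ∈ Finset.range (m + 1), (m.choose i : ℝ) * (-1 : ℝ) ^ i * a i
        = (((m + 1 : ℕ) : ℝ) - σ * (j + 1 : ℕ)) *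
          ∑ i ∈ Finset.range (m + 1 + 1), ((m + 1).choose i : ℝ) * (-1 : ℝ) ^ i * a i
          + σ * ∑ i ∈ Finset.range (m + 1 + 1), ((m + 1).choose i : ℝ) * (-1 : ℝ) ^ i * ((((j + 1 : ℕ) : ℝ) - i / σ) * a i) := by
      rw [Finset.mul_sum, Finset.mul_sum, Finset.mul_sum, ← Finset.sum_add_distrib,
        Finset.sum_range_succ _ (m + 1)]
      have last : ∀ A : ℝ, ∀ B : ℝ, B = 0 → A = A + B := fun A B h => by rw [h, add_zero]
      have hc : ∀ i ∈ Finset.range (m + 1), ((m + 1 : ℕ) : ℝ) * ((m.choose i : ℝ) * (-1 : ℝ) ^ i * a i) =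
          (((m + 1 : ℕ) : ℝ) - σ * (j + 1 : ℕ)) * (((m + 1).choose i : ℝ) * (-1 : ℝ) ^ i * a i)
          + σ * (((m + 1).choose i : ℝ) * (-1 : ℝ) ^ i * ((((j + 1 : ℕ) : ℝ) - i / σ) * a i)) := by
        intro i hi
        have hi' : i ≤ m + 1 := (Finset.mem_range.mp hi).le
        have h1 := congrArg (Nat.cast : ℕ → ℝ) (Nat.choose_mul_succ_eq m i)
        simp only [Nat.cast_mul, Nat.cast_sub hi'] at h1
        have h3 : σ * (i / σ) = i := by field_simp
        linear_combination ((-1 : ℝ) ^ i * a i) * h1 + ((m + 1).choose i : ℝ) * (-1 : ℝ) ^ i * a i * h3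
      rw [Finset.sum_congr rfl hc]
      apply last
      have h3 : σ * (((m + 1 : ℕ) : ℝ) / σ) = ((m + 1 : ℕ) : ℝ) := by field_simp
      linear_combination (-((m + 1).choose (m + 1) : ℝ) * (-1 : ℝ) ^ (m + 1) * a (m + 1)) * h3
    rw [hS2]
    have hG : Real.Gamma ((m + 1 + 1 : ℕ) : ℝ) = ((m + 1 : ℕ) : ℝ) * Real.Gamma ((m + 1 : ℕ) : ℝ) := by
      rw [← Real.Gamma_add_one (by positivity)]
      push_cast
      rfl
    have hG0 : Real.Gamma ((m + 1 : ℕ) : ℝ) ≠ 0 := (Real.Gamma_pos_of_pos (by positivity)).ne'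
    have hm : ((m + 1 : ℕ) : ℝ) ≠ 0 := by positivity
    rw [hG]
    have as : ∀ (c : ℝ) (i : ℕ), c * β ^ ((i : ℝ) / σ) *
        upperIncGamma (((j + 1 : ℕ) : ℝ) - (i : ℝ) / σ) β = c * a i :=
      fun c i => mul_assoc _ _ _
    simp only [as]
    generalize (∑ i ∈ Finset.range (m + 1), (m.choose i : ℝ) * (-1 : ℝ) ^ i * a i) = A at *
    generalize (∑ i ∈ Finset.range (m + 1 + 1), ((m + 1).choose i : ℝ) * (-1 : ℝ) ^ i * a i) = B at *
    generalize (∑ i ∈ Finset.range (m + 1 + 1), ((m + 1).choose i : ℝ) * (-1 : ℝ) ^ i * ((((j + 1 : ℕ) : ℝ) - i / σ) * a i)) = C at *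
    generalize Real.Gamma ((m + 1 : ℕ) : ℝ) = G at *
    generalize ((m + 1 : ℕ) : ℝ) = M at *
    generalize ((j + 1 : ℕ) : ℝ) = K at *
    rw [pow_succ]
    field_simp
    linear_combination key
  · have h := term 0 0
    simp at h
    simp [nggV, h, ← Real.exp_add]
end

section
/- Let σ < 1 and let {V_{n,k} : n ≥ 1, 1 ≤ k ≤ n} be a triangular array of reals satisfying the Gibbs-type recursion V_{n,k} = (n - σk) V_{n+1,k} + V_{n+1,k+1}. Define, for every k ≥ 1 and positive integers n_1, …, n_k with n = n_1 + ⋯ + n_k, the function p(n_1, …, n_k) = V_{n,k} ∏_{i=1}^k (1-σ)_{n_i - 1}. Then p satisfies the addition rule: p(n_1, …, n_k) = p(n_1, …, n_k, 1) + ∑_{j=1}^k p(n_1, …, n_j + 1, …, n_k). -/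
/-- The Gibbs-type EPPF `p(n_1, …, n_k) = V_{n,k} ∏_{i=1}^k (1-σ)_{n_i - 1}` with
`n = n_1 + ⋯ + n_k`. -/
noncomputable def gibbsEPPF (σ : ℝ) (V : ℕ → ℕ → ℝ) {k : ℕ} (ν : Fin k → ℕ) : ℝ :=
  V (∑ i, ν i) k * ∏ i, risingFactorial (1 - σ) (ν i - 1)

/-- If `σ < 1` and the triangular array `V` satisfies the Gibbs-type recursion
`V_{n,k} = (n - σk) V_{n+1,k} + V_{n+1,k+1}` for `1 ≤ k ≤ n`, then the EPPF
`p(n_1, …, n_k) = V_{n,k} ∏_{i=1}^k (1-σ)_{n_i-1}` satisfies the addition rule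
`p(n_1, …, n_k) = p(n_1, …, n_k, 1) + ∑_{j=1}^k p(n_1, …, n_j + 1, …, n_k)`. -/
theorem gibbs_eppf_addition_rule (σ : ℝ) (hσ : σ < 1) (V : ℕ → ℕ → ℝ)
    (hrec : ∀ n k : ℕ, 1 ≤ k → k ≤ n →
      V n k = ((n : ℝ) - σ * k) * V (n + 1) k + V (n + 1) (k + 1))
    (k : ℕ) (hk : 1 ≤ k) (ν : Fin k → ℕ) (hν : ∀ i, 1 ≤ ν i) :
    gibbsEPPF σ V ν =
      gibbsEPPF σ V (Fin.snoc ν 1) +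
        ∑ j : Fin k, gibbsEPPF σ V (Function.update ν j (ν j + 1)) := by
  have hle : k ≤ ∑ i, ν i := by
    calc k = ∑ _i : Fin k, 1 := by simp
      _ ≤ _ := Finset.sum_le_sum (fun i _ => hν i)
  have hsnoc : gibbsEPPF σ V (Fin.snoc ν 1 : Fin (k + 1) → ℕ) =
      V ((∑ i, ν i) + 1) (k + 1) * ∏ i, risingFactorial (1 - σ) (ν i - 1) := by
    simp [gibbsEPPF, Fin.sum_univ_castSucc, Fin.prod_univ_castSucc, risingFactorial]
  have hupd : ∀ j : Fin k, gibbsEPPF σ V (Function.update ν j (ν j + 1)) =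
      (V ((∑ i, ν i) + 1) k * ∏ i, risingFactorial (1 - σ) (ν i - 1)) * ((ν j : ℝ) - σ) := by
    intro j
    have hs : ∑ i, Function.update ν j (ν j + 1) i = (∑ i, ν i) + 1 := by
      rw [Finset.sum_update_of_mem (Finset.mem_univ j), Finset.sdiff_singleton_eq_erase,
        ← Finset.add_sum_erase Finset.univ ν (Finset.mem_univ j)]
      ring
    have hp : ∏ i, risingFactorial (1 - σ) (Function.update ν j (ν j + 1) i - 1) =
        (∏ i, risingFactorial (1 - σ) (ν i - 1)) * ((ν j : ℝ) - σ) := by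
      rw [← Finset.mul_prod_erase _ _ (Finset.mem_univ j),
        ← Finset.mul_prod_erase Finset.univ (fun i => risingFactorial (1 - σ) (ν i - 1))
          (Finset.mem_univ j)]
      have he : ∏ i ∈ Finset.univ.erase j,
          risingFactorial (1 - σ) (Function.update ν j (ν j + 1) i - 1) =
          ∏ i ∈ Finset.univ.erase j, risingFactorial (1 - σ) (ν i - 1) := by
        refine Finset.prod_congr rfl fun i hi => ?_
        rw [Function.update_of_ne (Finset.ne_of_mem_erase hi)]
      rw [he, Function.update_self]
      obtain ⟨m, hm⟩ := Nat.exists_eq_add_of_le' (hν j)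
      simp only [hm, Nat.add_sub_cancel, risingFactorial]
      push_cast
      ring
    unfold gibbsEPPF
    rw [hs, hp]
    ring
  rw [hsnoc, Finset.sum_congr rfl (fun j _ => hupd j), ← Finset.mul_sum, Finset.sum_sub_distrib]
  unfold gibbsEPPF
  rw [hrec _ k hk hle]
  simp only [Finset.sum_const, Finset.card_univ, Fintype.card_fin, nsmul_eq_mul]
  push_cast
  ring
end

section
/- For every real σ ≠ 0 and integers 1 ≤ k ≤ n, the sum over all ordered compositions (n_1, …, n_k) of n into k positive integer parts satisfies ∑_{(n_1,…,n_k): n_i ≥ 1, ∑ n_i = n} (n! / ∏_{i=1}^k n_i!) ∏_{i=1}^k (1-σ)_{n_i - 1} = σ^{-k} ∑_{i=0}^k (-1)^i C(k,i) (-iσ)_n. -/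
namespace GFC
open PowerSeries

noncomputable def E (x : ℝ) : PowerSeries ℝ :=
  PowerSeries.mk fun n => risingFactorial x n / (n.factorial : ℝ)

lemma ode_E (x : ℝ) : (1 - X) * derivative ℝ (E x) = C x * E x := by
  ext n
  rw [sub_mul, one_mul, map_sub, coeff_C_mul]
  cases n with
  | zero =>
    simp [E, coeff_derivative, risingFactorial]
  | succ n =>
    rw [coeff_succ_X_mul]
    simp only [E, coeff_derivative, coeff_mk, risingFactorial, Nat.factorial_succ]
    have : (n.factorial : ℝ) ≠ 0 := by positivity
    have : (n : ℝ) + 1 ≠ 0 := by positivity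
    have : (n : ℝ) + 1 + 1 ≠ 0 := by positivity
    push_cast
    field_simp
    ring

lemma ode_unique (x : ℝ) (p : PowerSeries ℝ) (h0 : coeff 0 p = 1)
    (h : (1 - X) * derivative ℝ p = C x * p) : p = E x := by
  ext n
  induction n with
  | zero => simpa [E, risingFactorial] using h0
  | succ n ih =>
    have h1 := congrArg (coeff n) h
    rw [sub_mul, one_mul, map_sub, coeff_C_mul] at h1
    have h2 : coeff n (X * derivative ℝ p) = n * coeff n p := by
      cases n with
      | zero => simp
      | succ m => rw [coeff_succ_X_mul, coeff_derivative]; push_cast; ring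
    rw [h2, coeff_derivative, ih] at h1
    have h3 : coeff (n + 1) p * ((n : ℝ) + 1) = (x + n) * coeff n (E x) := by linarith
    have : (n.factorial : ℝ) ≠ 0 := by positivity
    have : (n : ℝ) + 1 ≠ 0 := by positivity
    rw [← mul_left_inj' this, h3]
    simp only [E, coeff_mk, risingFactorial, Nat.factorial_succ]
    push_cast
    field_simp

lemma E_add (x y : ℝ) : E x * E y = E (x + y) := by
  apply ode_unique
  · simp [E, risingFactorial]
  · rw [Derivation.leibniz, smul_eq_mul, smul_eq_mul, map_add]
    linear_combination E x * ode_E y + E y * ode_E x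

lemma E_zero : E 0 = 1 := by
  symm
  apply ode_unique <;> simp

lemma E_pow (x : ℝ) (i : ℕ) : E x ^ i = E (i * x) := by
  induction i with
  | zero => simp [E_zero]
  | succ i ih => rw [pow_succ, ih, E_add]; congr 1; push_cast; ring

lemma rf_succ (x : ℝ) (n : ℕ) :
    risingFactorial x (n + 1) = x * risingFactorial (x + 1) n := by
  induction n with
  | zero => simp [risingFactorial]
  | succ n ih =>
    rw [risingFactorial, ih, risingFactorial]; push_cast; ring

noncomputable def W (s : ℝ) : PowerSeries ℝ :=
  PowerSeries.mk fun n => if 1 ≤ n then risingFactorial (1 - s) (n - 1) / (n.factorial : ℝ) else 0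

lemma W_eq (s : ℝ) (hs : s ≠ 0) : W s = C s⁻¹ * (1 - E (-s)) := by
  ext n
  rw [coeff_C_mul, map_sub]
  cases n with
  | zero => simp [W, E, risingFactorial]
  | succ n =>
    simp only [W, E, coeff_mk, rf_succ, coeff_one]
    have : (-s + 1) = 1 - s := by ring
    rw [this]
    simp
    field_simp

lemma coeff_W_pow (s : ℝ) (k n : ℕ) : coeff n (W s ^ k) =
    ∑ ν ∈ Finset.Nat.antidiagonalTuple k n, ∏ i, coeff (ν i) (W s) := by
  have h : W s ^ k = ∏ _i : Fin k, W s := by simp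
  rw [h, coeff_prod]
  refine Finset.sum_nbij' (fun f => (f : Fin k → ℕ)) (fun ν => Finsupp.equivFunOnFinite.symm ν)
    ?_ ?_ ?_ ?_ ?_
  · intro f hf
    simpa [Finset.Nat.mem_antidiagonalTuple, Finset.mem_finsuppAntidiag] using hf
  · intro f hf
    simpa [Finset.Nat.mem_antidiagonalTuple, Finset.mem_finsuppAntidiag] using hf
  · intro f hf
    ext; simp
  · intro f hf
    ext; simp
  · intro f hf
    rfl

end GFC

/-- For every real `σ ≠ 0` and integers `1 ≤ k ≤ n`, the sum over all ordered
compositions `(n_1, …, n_k)` of `n` into `k` positive integer parts satisfies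
`∑ (n!/∏ n_i!) ∏_{i=1}^k (1-σ)_{n_i-1} = σ^{-k} ∑_{i=0}^k (-1)^i C(k,i) (-iσ)_n`. -/
theorem composition_sum_genFactCoeff (σ : ℝ) (hσ : σ ≠ 0) (n k : ℕ)
    (hk : 1 ≤ k) (hkn : k ≤ n) :
    ∑ ν ∈ (Finset.Nat.antidiagonalTuple k n).filter (fun ν => ∀ i, 1 ≤ ν i),
        ((n.factorial : ℝ) / ∏ i, ((ν i).factorial : ℝ)) *
          ∏ i, risingFactorial (1 - σ) (ν i - 1) =
      σ⁻¹ ^ k *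
        ∑ i ∈ Finset.range (k + 1),
          (-1 : ℝ) ^ i * (k.choose i : ℝ) * risingFactorial (-(i : ℝ) * σ) n := by
  have key : PowerSeries.coeff n (GFC.W σ ^ k) = σ⁻¹ ^ k *
        ∑ i ∈ Finset.range (k + 1),
          (-1 : ℝ) ^ i * (k.choose i : ℝ) *
            (risingFactorial (-(i : ℝ) * σ) n / (n.factorial : ℝ)) := by
    rw [GFC.W_eq σ hσ, mul_pow, ← map_pow, PowerSeries.coeff_C_mul]
    congr 1
    have h : (1 - GFC.E (-σ)) = (-GFC.E (-σ)) + 1 := by ring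
    rw [h, add_pow, map_sum]
    refine Finset.sum_congr rfl fun i _ => ?_
    have h2 : (-GFC.E (-σ)) ^ i * 1 ^ (k - i) * ((k.choose i : ℕ) : PowerSeries ℝ)
        = PowerSeries.C ((-1 : ℝ) ^ i * (k.choose i : ℝ)) * GFC.E (-(i : ℝ) * σ) := by
      rw [neg_pow, GFC.E_pow]
      have : (i : ℝ) * -σ = -(i : ℝ) * σ := by ring
      rw [this]
      simp
      ring
    rw [h2, PowerSeries.coeff_C_mul]
    simp [GFC.E]
  have hn : (n.factorial : ℝ) ≠ 0 := by positivity
  have key2 : σ⁻¹ ^ k * ∑ i ∈ Finset.range (k + 1),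
          (-1 : ℝ) ^ i * (k.choose i : ℝ) * risingFactorial (-(i : ℝ) * σ) n
      = n.factorial * PowerSeries.coeff n (GFC.W σ ^ k) := by
    rw [key, mul_left_comm, Finset.mul_sum (a := (n.factorial : ℝ))]
    congr 1
    refine Finset.sum_congr rfl fun i _ => ?_
    field_simp
  rw [key2, GFC.coeff_W_pow, Finset.mul_sum, Finset.sum_filter]
  refine Finset.sum_congr rfl fun ν _ => ?_
  split_ifs with h
  · have : ∏ i, PowerSeries.coeff (ν i) (GFC.W σ) =
        ∏ i, (risingFactorial (1 - σ) (ν i - 1) / ((ν i).factorial : ℝ)) :=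
      Finset.prod_congr rfl fun i _ => by rw [GFC.W, PowerSeries.coeff_mk, if_pos (h i)]
    rw [this, Finset.prod_div_distrib]
    ring
  · push Not at h
    obtain ⟨i, hi⟩ := h
    rw [Finset.prod_eq_zero (Finset.mem_univ i), mul_zero]
    rw [GFC.W, PowerSeries.coeff_mk, if_neg (by omega)]
end

section
/- Let σ < 1, σ ≠ 0, and let {V_{n,k} : n ≥ 1, 1 ≤ k ≤ n} satisfy the Gibbs-type recursion V_{n,k} = (n - σk) V_{n+1,k} + V_{n+1,k+1} with V_{1,1} = 1. Then for every n ≥ 1 the distribution of the number of blocks sums to one: ∑_{k=1}^n V_{n,k} σ^{-k} 𝒞(n,k;σ) = 1, where 𝒞(n,k;σ) = (1/k!) ∑_{i=0}^k (-1)^i C(k,i) (-iσ)_n. -/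
/-- Generalized factorial coefficient
`𝒞(n,k;σ) = (1/k!) ∑_{i=0}^k (-1)^i C(k,i) (-iσ)_n`. -/
noncomputable def genFactCoeff (σ : ℝ) (n k : ℕ) : ℝ :=
  (1 / (k.factorial : ℝ)) *
    ∑ i ∈ Finset.range (k + 1),
      (-1 : ℝ) ^ i * (k.choose i : ℝ) * risingFactorial (-(i : ℝ) * σ) n

theorem gfc_succ (σ : ℝ) (n k : ℕ) :
    genFactCoeff σ (n + 1) (k + 1) =
      ((n : ℝ) - σ * ((k : ℝ) + 1)) * genFactCoeff σ n (k + 1) + σ * genFactCoeff σ n k := by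
  have hk : ((k.factorial : ℕ) : ℝ) ≠ 0 := by exact_mod_cast k.factorial_ne_zero
  have hk1 : (k : ℝ) + 1 ≠ 0 := by positivity
  have key : ∑ i ∈ Finset.range (k + 1 + 1),
      (-1 : ℝ) ^ i * ((k + 1).choose i : ℝ) * risingFactorial (-(i : ℝ) * σ) (n + 1) =
      ((n : ℝ) - σ * ((k : ℝ) + 1)) * ∑ i ∈ Finset.range (k + 1 + 1),
      (-1 : ℝ) ^ i * ((k + 1).choose i : ℝ) * risingFactorial (-(i : ℝ) * σ) n +
      σ * ((k : ℝ) + 1) * ∑ i ∈ Finset.range (k + 1),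
      (-1 : ℝ) ^ i * (k.choose i : ℝ) * risingFactorial (-(i : ℝ) * σ) n := by
    have h2 : ∑ i ∈ Finset.range (k + 1),
        (-1 : ℝ) ^ i * (k.choose i : ℝ) * risingFactorial (-(i : ℝ) * σ) n =
        ∑ i ∈ Finset.range (k + 1 + 1),
        (-1 : ℝ) ^ i * (k.choose i : ℝ) * risingFactorial (-(i : ℝ) * σ) n := by
      rw [Finset.sum_range_succ _ (k + 1)]
      simp
    rw [h2, Finset.mul_sum, Finset.mul_sum, ← Finset.sum_add_distrib]
    refine Finset.sum_congr rfl fun i hi => ?_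
    have hi' : i ≤ k + 1 := by
      have := Finset.mem_range.mp hi
      omega
    have hc : ((k : ℝ) + 1) * (k.choose i : ℝ) =
        ((k + 1).choose i : ℝ) * ((k : ℝ) + 1 - i) := by
      have h := Nat.choose_mul_succ_eq k i
      have h' : ((k.choose i * (k + 1) : ℕ) : ℝ) = (((k + 1).choose i * (k + 1 - i) : ℕ) : ℝ) := by
        exact_mod_cast h
      rw [Nat.cast_mul, Nat.cast_mul, Nat.cast_sub hi'] at h'
      push_cast at h'
      linarith
    simp only [risingFactorial]
    linear_combination (-(σ * (-1 : ℝ) ^ i * risingFactorial (-(i : ℝ) * σ) n)) * hc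
  unfold genFactCoeff
  rw [key, Nat.factorial_succ]
  push_cast
  field_simp

theorem gfc_eq_zero (σ : ℝ) (n : ℕ) : ∀ k, n < k → genFactCoeff σ n k = 0 := by
  induction n with
  | zero =>
    intro k hk
    have h := Int.alternating_sum_range_choose_of_ne (n := k) (by omega)
    have h' : ∑ i ∈ Finset.range (k + 1), (-1 : ℝ) ^ i * (k.choose i : ℝ) = 0 := by
      exact_mod_cast h
    simp [genFactCoeff, risingFactorial, h']
  | succ n ih =>
    intro k hk
    obtain ⟨k, rfl⟩ : ∃ j, k = j + 1 := ⟨k - 1, by omega⟩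
    rw [gfc_succ, ih _ (by omega), ih _ (by omega)]
    simp

theorem rf_zero (n : ℕ) : risingFactorial 0 (n + 1) = 0 := by
  induction n with
  | zero => simp [risingFactorial]
  | succ n ih => rw [risingFactorial, ih, zero_mul]

theorem gfc_zero_right (σ : ℝ) (n : ℕ) (hn : 1 ≤ n) : genFactCoeff σ n 0 = 0 := by
  obtain ⟨m, rfl⟩ : ∃ j, n = j + 1 := ⟨n - 1, by omega⟩
  simp [genFactCoeff, rf_zero]

/-- Let `σ < 1`, `σ ≠ 0`, and let `V` satisfy the Gibbs-type recursion
`V_{n,k} = (n - σk) V_{n+1,k} + V_{n+1,k+1}` for `1 ≤ k ≤ n`, with `V_{1,1} = 1`.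
Then for every `n ≥ 1` the distribution of the number of blocks sums to one:
`∑_{k=1}^n V_{n,k} σ^{-k} 𝒞(n,k;σ) = 1`. -/
theorem gibbs_number_of_blocks_sums_to_one (σ : ℝ) (hσ1 : σ < 1) (hσ0 : σ ≠ 0)
    (V : ℕ → ℕ → ℝ)
    (hrec : ∀ n k : ℕ, 1 ≤ k → k ≤ n →
      V n k = ((n : ℝ) - σ * k) * V (n + 1) k + V (n + 1) (k + 1))
    (hV11 : V 1 1 = 1) :
    ∀ n : ℕ, 1 ≤ n →
      ∑ k ∈ Finset.Icc 1 n, V n k * σ⁻¹ ^ k * genFactCoeff σ n k = 1 := by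
  have conv : ∀ (f : ℕ → ℝ) (n : ℕ),
      ∑ k ∈ Finset.Icc 1 n, f k = ∑ j ∈ Finset.range n, f (j + 1) := by
    intro f n
    induction n with
    | zero => simp
    | succ n ih => rw [Finset.sum_Icc_succ_top (by omega), ih, Finset.sum_range_succ]
  intro n hn
  induction n, hn using Nat.le_induction with
  | base =>
    simp [genFactCoeff, risingFactorial, Finset.sum_range_succ, hV11, hσ0]
  | succ n hn ih =>
    rw [conv] at ih ⊢
    rw [← ih]
    have step : ∀ j, V (n + 1) (j + 1) * σ⁻¹ ^ (j + 1) * genFactCoeff σ (n + 1) (j + 1) =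
        V (n + 1) (j + 1) * ((n : ℝ) - σ * ((j : ℝ) + 1)) * σ⁻¹ ^ (j + 1) *
          genFactCoeff σ n (j + 1) + V (n + 1) (j + 1) * σ⁻¹ ^ j * genFactCoeff σ n j := by
      intro j
      rw [gfc_succ, pow_succ]
      field_simp
    simp only [step]
    rw [Finset.sum_add_distrib, Finset.sum_range_succ, Finset.sum_range_succ' _ n,
      gfc_eq_zero σ n (n + 1) (by omega), gfc_zero_right σ n hn, mul_zero, mul_zero,
      add_zero, add_zero, ← Finset.sum_add_distrib]
    refine Finset.sum_congr rfl fun j hj => ?_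
    have hj' := Finset.mem_range.mp hj
    rw [hrec n (j + 1) (by omega) (by omega)]
    push_cast
    ring
end

section
/- For σ ∈ (0,1), θ > -σ, and integers 1 ≤ k ≤ n and m ≥ 1, the conditional distribution of the number of new species for the Pitman–Yor process is a probability distribution: ∑_{j=0}^m (θ/σ + k)_j 𝒞(m,j;σ,-n+kσ) / (θ+n)_m = 1, where 𝒞(m,j;σ,-n+kσ) = (1/j!) ∑_{r=0}^j (-1)^r C(j,r) (n - σ(r+k))_m. -/
/-- Non-central generalized factorial coefficient
`𝒞(m,j;σ,-n+kσ) = (1/j!) ∑_{r=0}^j (-1)^r C(j,r) (n - σ(r+k))_m`. -/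
noncomputable def ncGenFactCoeff (σ : ℝ) (n k m j : ℕ) : ℝ :=
  (1 / (j.factorial : ℝ)) *
    ∑ r ∈ Finset.range (j + 1),
      (-1 : ℝ) ^ r * (j.choose r : ℝ) * risingFactorial ((n : ℝ) - σ * ((r : ℝ) + k)) m

theorem nc_zero (σ : ℝ) (n k : ℕ) (j : ℕ) :
    ncGenFactCoeff σ n k 0 j = if j = 0 then 1 else 0 := by
  have h := Int.alternating_sum_range_choose (n := j)
  have h' : ∑ r ∈ Finset.range (j + 1), (-1 : ℝ) ^ r * (j.choose r : ℝ)
      = if j = 0 then 1 else 0 := by exact_mod_cast h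
  simp only [ncGenFactCoeff, risingFactorial, mul_one, h']
  split_ifs with hj
  · simp [hj]
  · simp

theorem nc_succ_zero (σ : ℝ) (n k m : ℕ) :
    ncGenFactCoeff σ n k (m + 1) 0 = ((n : ℝ) - σ * k + m) * ncGenFactCoeff σ n k m 0 := by
  simp [ncGenFactCoeff, risingFactorial]
  ring

theorem nc_succ_succ (σ : ℝ) (n k m j : ℕ) :
    ncGenFactCoeff σ n k (m + 1) (j + 1) =
      ((n : ℝ) - σ * k + m - σ * (j + 1)) * ncGenFactCoeff σ n k m (j + 1)
        + σ * ncGenFactCoeff σ n k m j := by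
  have h1 : ∑ r ∈ Finset.range (j + 1 + 1), (-1 : ℝ) ^ r * ((j + 1).choose r : ℝ) *
        risingFactorial ((n : ℝ) - σ * ((r : ℝ) + k)) (m + 1)
      = ((n : ℝ) - σ * k + m - σ * (j + 1)) *
        (∑ r ∈ Finset.range (j + 1 + 1), (-1 : ℝ) ^ r * ((j + 1).choose r : ℝ) *
          risingFactorial ((n : ℝ) - σ * ((r : ℝ) + k)) m)
        + σ * (j + 1) * ∑ r ∈ Finset.range (j + 1), (-1 : ℝ) ^ r * (j.choose r : ℝ) *
          risingFactorial ((n : ℝ) - σ * ((r : ℝ) + k)) m := by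
    have h2 : ∑ r ∈ Finset.range (j + 1), (-1 : ℝ) ^ r * (j.choose r : ℝ) *
          risingFactorial ((n : ℝ) - σ * ((r : ℝ) + k)) m
        = ∑ r ∈ Finset.range (j + 1 + 1), (-1 : ℝ) ^ r * (j.choose r : ℝ) *
          risingFactorial ((n : ℝ) - σ * ((r : ℝ) + k)) m := by
      rw [Finset.sum_range_succ _ (j + 1)]
      simp
    rw [h2, Finset.mul_sum, Finset.mul_sum, ← Finset.sum_add_distrib]
    apply Finset.sum_congr rfl
    intro r hr
    have hr' : r ≤ j + 1 := by
      have := Finset.mem_range.mp hr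
      omega
    have h3 : ((j : ℝ) + 1) * (j.choose r : ℝ)
        = ((j + 1).choose r : ℝ) * ((j : ℝ) + 1 - r) := by
      have h4 := Nat.choose_mul_succ_eq j r
      have h5 : ((j.choose r : ℕ) : ℝ) * ((j : ℝ) + 1)
          = ((j + 1).choose r : ℝ) * ((j + 1 - r : ℕ) : ℝ) := by exact_mod_cast h4
      rw [Nat.cast_sub hr'] at h5
      push_cast at h5
      linarith
    simp only [risingFactorial]
    linear_combination (-σ * (-1 : ℝ) ^ r *
      risingFactorial ((n : ℝ) - σ * ((r : ℝ) + k)) m) * h3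
  have hf : ((j.factorial : ℕ) : ℝ) ≠ 0 := by exact_mod_cast j.factorial_ne_zero
  have hj : (j : ℝ) + 1 ≠ 0 := by positivity
  unfold ncGenFactCoeff
  rw [h1, Nat.factorial_succ]
  push_cast
  field_simp

theorem nc_eq_zero (σ : ℝ) (n k m : ℕ) : ∀ j, m < j → ncGenFactCoeff σ n k m j = 0 := by
  induction m with
  | zero =>
    intro j hj
    rw [nc_zero, if_neg (by omega)]
  | succ m ih =>
    intro j hj
    obtain ⟨i, rfl⟩ : ∃ i, j = i + 1 := ⟨j - 1, by omega⟩
    rw [nc_succ_succ, ih _ (by omega), ih _ (by omega)]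
    ring

theorem nc_sum (σ x : ℝ) (n k m : ℕ) :
    ∑ j ∈ Finset.range (m + 1), risingFactorial x j * ncGenFactCoeff σ n k m j
      = risingFactorial ((n : ℝ) - σ * k + σ * x) m := by
  induction m with
  | zero => simp [nc_zero, risingFactorial]
  | succ m ih =>
    have key : ∀ N : ℕ,
        ∑ j ∈ Finset.range (N + 1), risingFactorial x j * ncGenFactCoeff σ n k (m + 1) j
        = ((n : ℝ) - σ * k + σ * x + m) *
            (∑ j ∈ Finset.range (N + 1), risingFactorial x j * ncGenFactCoeff σ n k m j)
          - σ * (x + N) * risingFactorial x N * ncGenFactCoeff σ n k m N := by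
      intro N
      induction N with
      | zero =>
        simp [nc_succ_zero, risingFactorial]
        ring
      | succ N ihN =>
        rw [Finset.sum_range_succ, ihN, Finset.sum_range_succ _ (N + 1), nc_succ_succ]
        simp only [risingFactorial]
        push_cast
        ring
    rw [key (m + 1), Finset.sum_range_succ, ih, nc_eq_zero σ n k m (m + 1) (by omega)]
    simp only [risingFactorial]
    ring

theorem rising_pos (x : ℝ) (hx : 0 < x) (m : ℕ) : 0 < risingFactorial x m := by
  induction m with
  | zero => simp [risingFactorial]
  | succ m ih =>
    simp only [risingFactorial]
    positivity

/-- For `σ ∈ (0,1)`, `θ > -σ`, and integers `1 ≤ k ≤ n`, `m ≥ 1`, the conditional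
distribution of the number of new species for the Pitman–Yor process is a probability
distribution: `∑_{j=0}^m (θ/σ + k)_j 𝒞(m,j;σ,-n+kσ) / (θ+n)_m = 1`. -/
theorem py_new_species_distribution_sums_to_one (σ θ : ℝ) (hσ0 : 0 < σ) (hσ1 : σ < 1)
    (hθ : θ > -σ) (n k m : ℕ) (hk : 1 ≤ k) (hkn : k ≤ n) (hm : 1 ≤ m) :
    ∑ j ∈ Finset.range (m + 1),
        risingFactorial (θ / σ + k) j * ncGenFactCoeff σ n k m j /
          risingFactorial (θ + n) m = 1 := by
  have hn : (1 : ℝ) ≤ n := by exact_mod_cast hk.trans hkn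
  have hpos := rising_pos (θ + n) (by linarith) m
  rw [← Finset.sum_div, nc_sum]
  have e : (n : ℝ) - σ * k + σ * (θ / σ + k) = θ + n := by
    field_simp
    ring
  rw [e, div_self hpos.ne']
end

section
/- Fix η ∈ (0,1) and define, for integers 1 ≤ k ≤ n, the mixed Gibbs-type weights with σ = -1 and geometric mixing: V_{n,k} = ∑_{m=k}^∞ (1-η) η^{m-1} · ((m-1)!/(m-k)!) / (m+1)_{n-1}. Then the diagonal ratio converges: lim_{n→∞} V_{n+1,n+1} / V_{n,n} = (2 − η − 2√(1−η)) / η, a value lying in [0,1]. -/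
open Filter

/-- Gibbs-type weights with `σ = -1` and geometric mixing distribution
`π(m) = (1-η)η^{m-1}`:
`V_{n,k} = ∑_{m=k}^∞ (1-η) η^{m-1} ((m-1)!/(m-k)!) / (m+1)_{n-1}`. -/
noncomputable def geomMixV (η : ℝ) (n k : ℕ) : ℝ :=
  ∑' m : ℕ, if k ≤ m then
      (1 - η) * η ^ (m - 1) * (((m - 1).factorial : ℝ) / ((m - k).factorial : ℝ)) /
        risingFactorial ((m : ℝ) + 1) (n - 1)
    else 0

/-- `q N m = ∏_{i<N} (m-i)/(m+2+i)`. -/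
noncomputable def gmQ : ℕ → ℕ → ℝ
  | 0, _ => 1
  | N + 1, m => gmQ N m * (((m : ℝ) - N) / (m + 2 + N))

lemma gmQ_zero_of_lt (N m : ℕ) (h : m < N) : gmQ N m = 0 := by
  induction N with
  | zero => omega
  | succ N ih =>
    rcases Nat.lt_succ_iff_lt_or_eq.mp h with h | h
    · simp [gmQ, ih h]
    · subst h; simp [gmQ]

lemma gmQ_bounds (N m : ℕ) : 0 ≤ gmQ N m ∧ gmQ (N + 1) m ≤ gmQ N m := by
  have key : ∀ N, 0 ≤ gmQ N m → 0 ≤ gmQ (N + 1) m ∧ gmQ (N + 1) m ≤ gmQ N m := by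
    intro N h0
    by_cases h : m < N
    · rw [gmQ_zero_of_lt N m h, gmQ_zero_of_lt (N + 1) m (by omega)]; simp
    · have h' : (N : ℝ) ≤ m := by exact_mod_cast not_lt.mp h
      have hN : (0 : ℝ) ≤ N := Nat.cast_nonneg N
      have c0 : 0 ≤ ((m : ℝ) - N) / (m + 2 + N) := div_nonneg (by linarith) (by linarith)
      have c1 : ((m : ℝ) - N) / (m + 2 + N) ≤ 1 := by
        rw [div_le_one (by linarith)]; linarith
      simp only [gmQ]
      exact ⟨mul_nonneg h0 c0, mul_le_of_le_one_right h0 c1⟩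
  have hn : ∀ N, 0 ≤ gmQ N m := by
    intro N
    induction N with
    | zero => simp [gmQ]
    | succ N ih => exact (key N ih).1
  exact ⟨hn N, (key N (hn N)).2⟩

lemma gmQ_le_one (N m : ℕ) : gmQ N m ≤ 1 := by
  induction N with
  | zero => simp [gmQ]
  | succ N ih => exact (gmQ_bounds N m).2.trans ih

lemma gmQ_self_pos (N m : ℕ) (h : N ≤ m) : 0 < gmQ N m := by
  induction N with
  | zero => simp [gmQ]
  | succ N ih =>
    have h' : (N : ℝ) < m := by exact_mod_cast h
    simp only [gmQ]
    exact mul_pos (ih (by omega)) (div_pos (by linarith) (by positivity))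

lemma gmQ_shift (N m : ℕ) : gmQ (N + 1) (m + 1) =
    gmQ N m * (((m : ℝ) + 1) * (m + 2) / ((m + 2 + N) * (m + 3 + N))) := by
  induction N with
  | zero =>
    have h2 : (m : ℝ) + 2 ≠ 0 := by positivity
    have h3 : (m : ℝ) + 3 ≠ 0 := by positivity
    have h4 : (m : ℝ) + 1 + 2 ≠ 0 := by positivity
    simp only [gmQ]; push_cast; simp only [add_zero, sub_zero]; field_simp; ring
  | succ N ih =>
    rw [gmQ, ih, gmQ]
    push_cast
    have h2 : (m : ℝ) + 2 + N ≠ 0 := by positivity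
    have h3 : (m : ℝ) + 3 + N ≠ 0 := by positivity
    have h4 : (m : ℝ) + 1 + 2 + (N + 1) ≠ 0 := by positivity
    have h5 : (m : ℝ) + 2 + (N + 1) ≠ 0 := by positivity
    have h6 : (m : ℝ) + 3 + (N + 1) ≠ 0 := by positivity
    field_simp; ring

lemma gmQ_rec (η : ℝ) (N m : ℕ) :
    η * (N + 1) / (2 * (2 * N + 3)) * (η ^ m * gmQ (N + 2) m)
      + η * (N + 2) / (2 * (2 * N + 3)) * (η ^ m * gmQ N m)
      - (1 - η / 2) * (η ^ m * gmQ (N + 1) m)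
      = η ^ (m + 1) * gmQ (N + 1) (m + 1) - η ^ m * gmQ (N + 1) m := by
  rw [gmQ_shift]
  simp only [gmQ]
  push_cast
  have h2 : (m : ℝ) + 2 + N ≠ 0 := by positivity
  have h3 : (m : ℝ) + 3 + N ≠ 0 := by positivity
  have h5 : (m : ℝ) + 2 + (N + 1) ≠ 0 := by positivity
  have h6 : 2 * (N : ℝ) + 3 ≠ 0 := by positivity
  field_simp; ring

noncomputable def gmU (η : ℝ) (N : ℕ) : ℝ := ∑' m : ℕ, η ^ m * gmQ N m

lemma gmU_summable (η : ℝ) (h0 : 0 < η) (h1 : η < 1) (N : ℕ) :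
    Summable (fun m : ℕ => η ^ m * gmQ N m) := by
  refine Summable.of_nonneg_of_le (fun m => mul_nonneg (by positivity) (gmQ_bounds N m).1)
    (fun m => ?_) (summable_geometric_of_lt_one h0.le h1)
  exact mul_le_of_le_one_right (by positivity) (gmQ_le_one N m)

lemma gmU_pos (η : ℝ) (h0 : 0 < η) (h1 : η < 1) (N : ℕ) : 0 < gmU η N :=
  (gmU_summable η h0 h1 N).tsum_pos
    (fun m => mul_nonneg (by positivity) (gmQ_bounds N m).1) N
    (mul_pos (by positivity) (gmQ_self_pos N N le_rfl))

lemma gmU_le (η : ℝ) (h0 : 0 < η) (h1 : η < 1) (N : ℕ) : gmU η (N + 1) ≤ gmU η N :=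
  (gmU_summable η h0 h1 (N + 1)).tsum_le_tsum
    (fun m => mul_le_mul_of_nonneg_left (gmQ_bounds N m).2 (by positivity))
    (gmU_summable η h0 h1 N)

lemma gmU_rec (η : ℝ) (h0 : 0 < η) (h1 : η < 1) (N : ℕ) :
    η * (N + 1) / (2 * (2 * N + 3)) * gmU η (N + 2)
      + η * (N + 2) / (2 * (2 * N + 3)) * gmU η N
      = (1 - η / 2) * gmU η (N + 1) := by
  have s0 := (gmU_summable η h0 h1 N).hasSum
  have s1 := (gmU_summable η h0 h1 (N + 1)).hasSum
  have s2 := (gmU_summable η h0 h1 (N + 2)).hasSum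
  have L := ((s2.mul_left (η * (N + 1) / (2 * (2 * N + 3)))).add
    (s0.mul_left (η * (N + 2) / (2 * (2 * N + 3))))).sub (s1.mul_left (1 - η / 2))
  have hz : gmQ (N + 1) 0 = 0 := gmQ_zero_of_lt _ _ (by omega)
  have s1' : HasSum (fun m : ℕ => η ^ (m + 1) * gmQ (N + 1) (m + 1))
      (∑' m : ℕ, η ^ m * gmQ (N + 1) m) := by
    have := (hasSum_nat_add_iff' (f := fun m : ℕ => η ^ m * gmQ (N + 1) m) 1).mpr s1
    simpa [hz] using this
  have R := s1'.sub s1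
  have := L.unique (by simpa only [gmQ_rec] using R)
  unfold gmU
  linarith

lemma rf_pos (x : ℝ) (hx : 0 < x) (N : ℕ) : 0 < risingFactorial x N := by
  induction N with
  | zero => simp [risingFactorial]
  | succ N ih => rw [risingFactorial]; positivity

lemma gm_term (N m : ℕ) (h : N ≤ m) :
    ((m.factorial : ℝ) / ((m - N).factorial : ℝ)) / risingFactorial ((m : ℝ) + 2) N
      = gmQ N m := by
  induction N with
  | zero =>
    have : (m.factorial : ℝ) ≠ 0 := by positivity
    simp [risingFactorial, gmQ, this]
  | succ N ih =>
    rw [gmQ, ← ih (by omega), risingFactorial]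
    obtain ⟨k, rfl⟩ := Nat.exists_eq_add_of_le h
    have e1 : N + 1 + k - N = k + 1 := by omega
    have e2 : N + 1 + k - (N + 1) = k := by omega
    rw [e1, e2, Nat.factorial_succ k]
    have := (rf_pos (((N + 1 + k : ℕ) : ℝ) + 2) (by positivity) N).ne'
    have hk : (k.factorial : ℝ) ≠ 0 := by positivity
    have h3 : ((N + 1 + k : ℕ) : ℝ) + 2 + N ≠ 0 := by positivity
    have h4 : (k : ℝ) + 1 ≠ 0 := by positivity
    have h5 : ((N + 1 + k : ℕ) : ℝ) - N = k + 1 := by push_cast; ring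
    rw [h5]
    push_cast at *
    field_simp

lemma geomMixV_eq (η : ℝ) (h0 : 0 < η) (h1 : η < 1) (N : ℕ) :
    geomMixV η (N + 1) (N + 1) = (1 - η) * gmU η N := by
  unfold geomMixV
  set f : ℕ → ℝ := fun m => if N + 1 ≤ m then
      (1 - η) * η ^ (m - 1) * (((m - 1).factorial : ℝ) / ((m - (N + 1)).factorial : ℝ)) /
        risingFactorial ((m : ℝ) + 1) (N + 1 - 1)
    else 0 with hf
  have ht : ∀ m, f (m + 1) = (1 - η) * (η ^ m * gmQ N m) := by
    intro m
    simp only [hf]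
    split_ifs with h
    · have h' : N ≤ m := by omega
      rw [← gm_term N m h']
      have e : ((m + 1 : ℕ) : ℝ) + 1 = m + 2 := by push_cast; ring
      simp only [e, Nat.add_sub_add_right, Nat.add_sub_cancel]
      ring
    · rw [gmQ_zero_of_lt N m (by omega)]; simp
  have s : HasSum (fun m => f (m + 1)) ((1 - η) * gmU η N) := by
    simp only [ht]
    exact (gmU_summable η h0 h1 N).hasSum.mul_left _
  have hf0 : f 0 = 0 := by simp [hf]
  have := (hasSum_nat_add_iff (f := f) 1).mp s
  simp only [Finset.sum_range_one, hf0, add_zero] at this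
  exact this.tsum_eq

lemma gm_tendsto (η α : ℝ) (h0 : 0 < η) (h1 : η < 1) (ha0 : 0 ≤ α) (ha1 : α ≤ 1)
    (hα : η / 4 * (α ^ 2 + 1) = (1 - η / 2) * α) :
    Tendsto (fun N : ℕ => gmU η (N + 1) / gmU η N) atTop (nhds α) := by
  set r : ℕ → ℝ := fun N => gmU η (N + 1) / gmU η N with hr
  have r0 : ∀ N, 0 ≤ r N := fun N => div_nonneg (gmU_pos η h0 h1 _).le (gmU_pos η h0 h1 _).le
  have r1 : ∀ N, r N ≤ 1 := fun N => by
    simp only [hr]; rw [div_le_one (gmU_pos η h0 h1 N)]; exact gmU_le η h0 h1 N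
  have hrec : ∀ N : ℕ, η / 4 * (r N * r (N + 1) + 1)
      + η / (4 * (2 * N + 3)) * (1 - r N * r (N + 1)) = (1 - η / 2) * r N := by
    intro N
    have a := (gmU_pos η h0 h1 N).ne'
    have b := (gmU_pos η h0 h1 (N + 1)).ne'
    have e : r N * r (N + 1) = gmU η (N + 2) / gmU η N := by
      simp only [hr]; field_simp
    have h6 : 2 * (N : ℝ) + 3 ≠ 0 := by positivity
    have := gmU_rec η h0 h1 N
    rw [e]; simp only [hr]
    rw [← mul_div_assoc, ← this]
    field_simp; ring
  set c : ℝ := 1 - 3 * η / 4 with hc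
  have hcpos : 0 < c := by rw [hc]; linarith
  have step : ∀ N : ℕ, c * |r N - α| ≤ η / 4 * |r (N + 1) - α| + η / (4 * (2 * N + 3)) := by
    intro N
    set ε := η / (4 * (2 * (N : ℝ) + 3)) with hε
    have he : 0 ≤ ε := by positivity
    have h := hrec N
    have id : (1 - η / 2 - η / 4 * α) * (r N - α)
        = η / 4 * (r N * (r (N + 1) - α)) + ε * (1 - r N * r (N + 1)) := by
      linear_combination -h + hα
    have p0 : 0 ≤ r N * r (N + 1) := mul_nonneg (r0 _) (r0 _)
    have p1 : r N * r (N + 1) ≤ 1 := mul_le_one₀ (r1 _) (r0 _) (r1 _)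
    have hle : c ≤ 1 - η / 2 - η / 4 * α := by rw [hc]; nlinarith
    calc c * |r N - α| ≤ (1 - η / 2 - η / 4 * α) * |r N - α| :=
          mul_le_mul_of_nonneg_right hle (abs_nonneg _)
      _ = |(1 - η / 2 - η / 4 * α) * (r N - α)| := by
          rw [abs_mul, abs_of_pos (lt_of_lt_of_le hcpos hle)]
      _ ≤ |η / 4 * (r N * (r (N + 1) - α))| + |ε * (1 - r N * r (N + 1))| := by
          rw [id]; exact abs_add_le _ _
      _ ≤ _ := by
          apply add_le_add
          · rw [abs_mul, abs_mul, abs_of_pos (by positivity : 0 < η / 4), abs_of_nonneg (r0 N)]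
            exact mul_le_mul_of_nonneg_left
              (mul_le_of_le_one_left (abs_nonneg _) (r1 N)) (by positivity)
          · rw [abs_of_nonneg (mul_nonneg he (by linarith))]
            exact mul_le_of_le_one_right he (by linarith)
  set k : ℝ := η / 4 / c with hk
  have hk0 : 0 ≤ k := by positivity
  have hk1 : k < 1 := by rw [hk, div_lt_one hcpos, hc]; linarith
  -- uniform bound by backward iteration
  have iter : ∀ j N : ℕ, |r N - α| ≤ k ^ j + η / (4 * (2 * N + 3)) / (1 - η) := by
    intro j
    induction j with
    | zero =>
      intro N
      have : |r N - α| ≤ 1 := by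
        rw [abs_le]; constructor <;> linarith [r0 N, r1 N]
      have : 0 ≤ η / (4 * (2 * (N : ℝ) + 3)) / (1 - η) :=
        div_nonneg (by positivity) (by linarith)
      simp only [pow_zero]; linarith
    | succ j ih =>
      intro N
      have hs := step N
      have hi := ih (N + 1)
      set ε := η / (4 * (2 * (N : ℝ) + 3)) with hε
      have mono : η / (4 * (2 * ((N + 1 : ℕ) : ℝ) + 3)) / (1 - η) ≤ ε / (1 - η) := by
        apply div_le_div_of_nonneg_right _ (by linarith)
        rw [hε]
        apply div_le_div_of_nonneg_left h0.le (by positivity)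
        push_cast; linarith
      have h2 : η / 4 * |r (N + 1) - α| ≤ η / 4 * (k ^ j + ε / (1 - η)) :=
        mul_le_mul_of_nonneg_left (hi.trans (by linarith)) (by positivity)
      have h3 : c * |r N - α| ≤ c * (k ^ (j + 1) + ε / (1 - η)) := by
        have e1 : c * k ^ (j + 1) = η / 4 * k ^ j := by
          rw [pow_succ, hk]; field_simp
        have e2 : c * (ε / (1 - η)) = η / 4 * (ε / (1 - η)) + ε := by
          have : 1 - η ≠ 0 := by linarith
          rw [hc]; field_simp; ring
        rw [mul_add, e1, e2]; linarith
      exact le_of_mul_le_mul_left h3 hcpos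
  have bound : ∀ N : ℕ, |r N - α| ≤ η / (4 * (2 * N + 3)) / (1 - η) := by
    intro N
    have t : Tendsto (fun j : ℕ => k ^ j + η / (4 * (2 * (N : ℝ) + 3)) / (1 - η)) atTop
        (nhds (0 + η / (4 * (2 * (N : ℝ) + 3)) / (1 - η))) :=
      (tendsto_pow_atTop_nhds_zero_of_lt_one hk0 hk1).add_const _
    rw [zero_add] at t
    exact ge_of_tendsto' t (fun j => iter j N)
  have lim : Tendsto (fun N : ℕ => η / (4 * (2 * (N : ℝ) + 3)) / (1 - η)) atTop (nhds 0) := by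
    have : Tendsto (fun N : ℕ => 4 * (2 * (N : ℝ) + 3)) atTop atTop := by
      apply Tendsto.const_mul_atTop (by norm_num)
      apply tendsto_atTop_add_const_right
      exact Tendsto.const_mul_atTop (by norm_num) tendsto_natCast_atTop_atTop
    simpa using (this.const_div_atTop η).div_const (1 - η)
  rw [tendsto_iff_dist_tendsto_zero]
  exact squeeze_zero (fun _ => dist_nonneg) (fun N => by rw [Real.dist_eq]; exact bound N) lim

/-- For `η ∈ (0,1)`, the diagonal ratio of the geometric-mixture Gibbs weights
converges: `lim_{n→∞} V_{n+1,n+1}/V_{n,n} = (2 − η − 2√(1−η))/η`, a value in `[0,1]`. -/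
theorem geom_mix_diagonal_ratio_limit (η : ℝ) (hη0 : 0 < η) (hη1 : η < 1) :
    Tendsto (fun n : ℕ => geomMixV η (n + 1) (n + 1) / geomMixV η n n) atTop
        (nhds ((2 - η - 2 * Real.sqrt (1 - η)) / η)) ∧
      (2 - η - 2 * Real.sqrt (1 - η)) / η ∈ Set.Icc (0 : ℝ) 1 := by
  set s := Real.sqrt (1 - η) with hs
  have s0 : 0 ≤ s := Real.sqrt_nonneg _
  have s2 : s ^ 2 = 1 - η := Real.sq_sqrt (by linarith)
  have s1 : s ≤ 1 := by nlinarith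
  have hmem : (2 - η - 2 * s) / η ∈ Set.Icc (0 : ℝ) 1 := by
    constructor
    · apply div_nonneg _ hη0.le
      nlinarith [sq_nonneg (1 - s)]
    · rw [div_le_one hη0]; nlinarith
  refine ⟨?_, hmem⟩
  have hα : η / 4 * (((2 - η - 2 * s) / η) ^ 2 + 1)
      = (1 - η / 2) * ((2 - η - 2 * s) / η) := by
    field_simp
    linear_combination 8 * s2
  have T := gm_tendsto η _ hη0 hη1 hmem.1 hmem.2 hα
  rw [← tendsto_add_atTop_iff_nat 1]
  refine T.congr (fun N => ?_)
  rw [geomMixV_eq η hη0 hη1 (N + 1), geomMixV_eq η hη0 hη1 N,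
    mul_div_mul_left _ _ (by linarith : (1 - η) ≠ 0)]
end
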